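/- arXiv:1706.01877 — 3 statements merged into one kernel-verified Lean document; each statement's English description precedes it below -/
import Mathlib

section
/- Let A be a unital C*-algebra and let a ∈ A be regular (i.e. a = a·b·a for some b ∈ A; equivalently, a is Moore-Penrose invertible). Then a·a† + a†·a − 1 is invertible in A if and only if a is core invertible; moreover, in that case (a·a† + a†·a − 1)⁻¹ = a⊕·a + (a⊕·a)* − 1. -/
open scoped Classical

/-- `x` is a Moore–Penrose inverse of `a`. -/
def IsMPInv {A : Type*} [Ring A] [StarRing A] (a x : A) : Prop :=
  a * x * a = a ∧ x * a * x = x ∧ star (a * x) = a * x ∧ star (x * a) = x * a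

/-- `x` is a group inverse of `a`. -/
def IsGroupInv {A : Type*} [Ring A] (a x : A) : Prop :=
  a * x * a = a ∧ x * a * x = x ∧ a * x = x * a

/-- `x` is a core inverse of `a`: `a·x·a = a`, `x·A = a·A`, `A·x = A·a*`. -/
def IsCoreInv {A : Type*} [Ring A] [StarRing A] (a x : A) : Prop :=
  a * x * a = a ∧ (Set.range fun y => x * y) = (Set.range fun y => a * y) ∧
    (Set.range fun y => y * x) = (Set.range fun y => y * star a)

/-- `x` is a dual core inverse of `a`: `a·x·a = a`, `x·A = a*·A`, `A·x = A·a`. -/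
def IsDualCoreInv {A : Type*} [Ring A] [StarRing A] (a x : A) : Prop :=
  a * x * a = a ∧ (Set.range fun y => x * y) = (Set.range fun y => star a * y) ∧
    (Set.range fun y => y * x) = (Set.range fun y => y * a)

/-- The Moore–Penrose inverse `a†` (or `0` if it does not exist). -/
noncomputable def mpInv {A : Type*} [Ring A] [StarRing A] (a : A) : A :=
  if h : ∃ x, IsMPInv a x then h.choose else 0

/-- The group inverse `a#` (or `0` if it does not exist). -/
noncomputable def groupInv {A : Type*} [Ring A] (a : A) : A :=
  if h : ∃ x, IsGroupInv a x then h.choose else 0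

/-- The core inverse `a⊕` (or `0` if it does not exist). -/
noncomputable def coreInv {A : Type*} [Ring A] [StarRing A] (a : A) : A :=
  if h : ∃ x, IsCoreInv a x then h.choose else 0

/-- The dual core inverse `a⊖` (or `0` if it does not exist). -/
noncomputable def dualCoreInv {A : Type*} [Ring A] [StarRing A] (a : A) : A :=
  if h : ∃ x, IsDualCoreInv a x then h.choose else 0

/-- The maximal angle `ψ_a ∈ [0, π/2]` between `a·a†` and `a†·a`, defined by
`sin ψ_a = ‖a·a† − a†·a‖` (and `ψ_a = 0` when `a = 0`). -/
noncomputable def maxAngle {A : Type*} [NormedRing A] [StarRing A] (a : A) : ℝ :=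
  Real.arcsin ‖a * mpInv a - mpInv a * a‖

/-- `δ(M, N)`: zero if `M = {0}`, otherwise the supremum of distances from
norm-one elements of `M` to `N`. -/
noncomputable def subDelta {E : Type*} [NormedAddCommGroup E] (M N : Set E) : ℝ :=
  if M = {0} then 0
  else sSup ((fun m => Metric.infDist m N) '' {m ∈ M | ‖m‖ = 1})

/-- The gap `θ(M, N)` between the subspaces `M` and `N`. -/
noncomputable def subGap {E : Type*} [NormedAddCommGroup E] (M N : Set E) : ℝ :=
  max (subDelta M N) (subDelta N M)

/-- The right ideal `a·A`. -/
def rIdeal {A : Type*} [Ring A] (a : A) : Set A := Set.range fun y => a * y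

/-- The left ideal `A·a`. -/
def lIdeal {A : Type*} [Ring A] (a : A) : Set A := Set.range fun y => y * a

/-- The right annihilator `a° = {x : a·x = 0}`. -/
def rAnn {A : Type*} [Ring A] (a : A) : Set A := {x | a * x = 0}

/-- The left annihilator `°a = {x : x·a = 0}`. -/
def lAnn {A : Type*} [Ring A] (a : A) : Set A := {x | x * a = 0}

theorem isUnit_one_sub_sq_of_star_eq_neg {A : Type*} [NormedRing A] [StarRing A] [CStarRing A]
    [CompleteSpace A] [NormedAlgebra ℂ A] [StarModule ℂ A] {s : A} (hs : star s = -s) :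
    IsUnit (1 - s * s) := by
  let _ : CStarAlgebra A := {}
  have hsa : IsSelfAdjoint (Complex.I • s) := by
    simp [isSelfAdjoint_iff, star_smul, hs]
  have unit_of_im (z : ℂ) (hz : z.im ≠ 0) : IsUnit (algebraMap ℂ A z - Complex.I • s) := by
    by_contra h
    have hre := hsa.mem_spectrum_eq_re (spectrum.mem_iff.mpr h)
    exact hz (by rw [hre]; simp)
  have key : (algebraMap ℂ A Complex.I - Complex.I • s) *
      (algebraMap ℂ A (-Complex.I) - Complex.I • s) = 1 - s * s := by
    simp only [Algebra.algebraMap_eq_smul_one, sub_mul, mul_sub, smul_mul_smul_comm, one_mul,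
      mul_one, mul_neg, neg_smul, Complex.I_mul_I, one_smul]
    abel
  rw [← key]
  exact (unit_of_im _ (by simp)).mul (unit_of_im _ (by simp))

/-- The range projection of an idempotent in a C⋆-algebra. -/
theorem exists_projection_of_idempotent {A : Type*} [NormedRing A] [StarRing A] [CStarRing A]
    [CompleteSpace A] [NormedAlgebra ℂ A] [StarModule ℂ A] {p : A} (hp : p * p = p) :
    ∃ e : A, star e = e ∧ p * e = e ∧ e * p = p := by
  obtain ⟨u, hu⟩ := isUnit_one_sub_sq_of_star_eq_neg (s := p - star p) (by simp)
  have hp' : star p * star p = star p := by rw [← star_mul, hp]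
  have hu' : (u : A) = 1 - p - star p + p * star p + star p * p := by
    rw [hu]; simp only [sub_mul, mul_sub, hp, hp']; abel
  have hpu : p * u = p * star p * p := by
    rw [hu']; simp only [mul_add, mul_sub, ← mul_assoc, hp, mul_one]; abel
  have hup : u * p = p * star p * p := by
    rw [hu']; simp only [add_mul, sub_mul, mul_assoc, hp, one_mul]; abel
  have hu_star : star (u : A) = u := by
    rw [hu']; simp only [star_add, star_sub, star_one, star_mul, star_star]; abel
  have hc : Commute p u := hpu.trans hup.symm
  have hc' : Commute (star p) u := by
    have := hc.star_star
    rwa [hu_star] at this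
  have hinv : star (↑u⁻¹ : A) = ↑u⁻¹ := by
    have h1 : star (↑u⁻¹ : A) * u = 1 := by
      have := congrArg star (u.mul_inv)
      rwa [star_mul, hu_star, star_one] at this
    exact eq_comm.mp (Units.inv_eq_of_mul_eq_one_left h1)
  refine ⟨p * star p * ↑u⁻¹, ?_, ?_, ?_⟩
  · rw [star_mul, star_mul, star_star, hinv]
    exact ((hc.mul_left hc').units_inv_right).symm
  · rw [← mul_assoc, ← mul_assoc, hp]
  · rw [mul_assoc, ← hc.units_inv_right.eq, ← mul_assoc, ← hpu, Units.mul_inv_cancel_right]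

theorem exists_isMPInv_of_regular {A : Type*} [NormedRing A] [StarRing A] [CStarRing A]
    [CompleteSpace A] [NormedAlgebra ℂ A] [StarModule ℂ A] {a : A}
    (ha : ∃ b, a * b * a = a) : ∃ x, IsMPInv a x := by
  obtain ⟨b, hb⟩ := ha
  obtain ⟨e, he, hpe, hep⟩ := exists_projection_of_idempotent (p := a * b)
    (by rw [← mul_assoc, hb])
  obtain ⟨f, hf, hqf, hfq⟩ := exists_projection_of_idempotent (p := star (b * a))
    (by rw [← star_mul, mul_assoc b a, ← mul_assoc a b a, hb])
  have hfq' : b * a * f = b * a := by simpa [hf] using congrArg star hfq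
  have hqf' : f * (b * a) = f := by simpa [hf] using congrArg star hqf
  have hea : e * a = a := by
    rw [← hb, ← mul_assoc, hep]
  have haf : a * f = a := by
    rw [← hb, mul_assoc a b a, mul_assoc, hfq']
  have hax : a * (f * b * e) = e := by rw [← mul_assoc, ← mul_assoc, haf, hpe]
  have hxa : f * b * e * a = f := by rw [mul_assoc, hea, mul_assoc, hqf']
  have hff : f * f = f := by
    nth_rewrite 1 [← hqf']
    rw [mul_assoc, hfq', hqf']
  refine ⟨f * b * e, by rw [hax, hea], ?_, by rw [hax, he], by rw [hxa, hf]⟩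
  rw [hxa, ← mul_assoc, ← mul_assoc, hff]

theorem mpInv_spec {A : Type*} [Ring A] [StarRing A] {a : A} (h : ∃ x, IsMPInv a x) :
    IsMPInv a (mpInv a) := by
  rw [mpInv, dif_pos h]
  exact h.choose_spec

theorem coreInv_spec {A : Type*} [Ring A] [StarRing A] {a : A} (h : ∃ x, IsCoreInv a x) :
    IsCoreInv a (coreInv a) := by
  rw [coreInv, dif_pos h]
  exact h.choose_spec

theorem IsCoreInv.mul_mul_self {A : Type*} [Ring A] [StarRing A] {a c : A}
    (h : IsCoreInv a c) : c * a * a = a := by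
  obtain ⟨h1, h2, h3⟩ := h
  obtain ⟨z, hz : c * z = a⟩ : a ∈ Set.range fun y => c * y := h2 ▸ ⟨1, mul_one a⟩
  obtain ⟨w, hw : w * star a = c⟩ : c ∈ Set.range fun y => y * star a := h3 ▸ ⟨1, one_mul c⟩
  have hc : c * star (a * c) = c := by
    have : star a * star (a * c) = star a := by rw [← star_mul, h1]
    calc c * star (a * c) = w * star a * star (a * c) := by rw [hw]
      _ = c := by rw [mul_assoc, this, hw]
  have hsa : star (a * c) = a * c := by
    have h : a * c * star (a * c) = a * c := by rw [mul_assoc, hc]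
    have h' := congrArg star h
    rw [star_mul, star_star, h] at h'
    exact h'.symm
  rw [hsa, ← mul_assoc] at hc
  nth_rewrite 2 [← hz]
  rw [← mul_assoc, hc, hz]

theorem IsMPInv.mul_eq_one_of_isCoreInv {A : Type*} [Ring A] [StarRing A] {a x c : A}
    (hx : IsMPInv a x) (hc : IsCoreInv a c) :
    (a * x + x * a - 1) * (c * a + star (c * a) - 1) = 1 := by
  obtain ⟨h1, -, hP, hQ⟩ := hx
  obtain ⟨y, hy : a * y = c⟩ : c ∈ Set.range fun y => a * y := hc.2.1 ▸ ⟨1, mul_one c⟩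
  have e1 : a * x * (c * a) = c * a := by rw [← hy, ← mul_assoc, ← mul_assoc, h1]
  have e2 : x * a * (c * a) = x * a := by rw [mul_assoc, ← mul_assoc a, hc.1]
  have e3 : a * x * star (c * a) = a * x := by
    have h : c * a * (a * x) = a * x := by rw [← mul_assoc, hc.mul_mul_self]
    have h' := congrArg star h
    rwa [star_mul, hP] at h'
  have e4 : x * a * star (c * a) = star (c * a) := by
    have h : c * a * (x * a) = c * a := by rw [mul_assoc, ← mul_assoc a, h1]
    have h' := congrArg star h
    rwa [star_mul, hQ] at h'
  simp only [add_mul, sub_mul, mul_add, mul_sub, e1, e2, e3, e4, mul_one, one_mul]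
  abel

theorem IsMPInv.mul_eq_one_of_isCoreInv' {A : Type*} [Ring A] [StarRing A] {a x c : A}
    (hx : IsMPInv a x) (hc : IsCoreInv a c) :
    (c * a + star (c * a) - 1) * (a * x + x * a - 1) = 1 := by
  have h := congrArg star (hx.mul_eq_one_of_isCoreInv hc)
  rwa [star_mul, star_sub, star_sub, star_add, star_add, star_star, hx.2.2.1, hx.2.2.2,
    star_one, add_comm (star (c * a))] at h

theorem IsMPInv.isCoreInv_of_inverse {A : Type*} [Ring A] [StarRing A] {a x h : A}
    (hx : IsMPInv a x) (hl : h * (a * x + x * a - 1) = 1) (hr : (a * x + x * a - 1) * h = 1) :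
    IsCoreInv a (h * x) := by
  obtain ⟨h1, h2, hP, hQ⟩ := hx
  set g := a * x + x * a - 1 with hg
  have hQg : x * a * g = x * a * (a * x) := by
    have : x * a * (x * a) = x * a := by rw [← mul_assoc, h2]
    rw [hg, mul_sub, mul_add, this, mul_one, add_sub_cancel_right]
  have hgP : g * (a * x) = x * a * (a * x) := by
    have : a * x * (a * x) = a * x := by rw [← mul_assoc, h1]
    rw [hg, sub_mul, add_mul, this, one_mul, add_sub_cancel_left]
  have hPg : a * x * g = a * x * (x * a) := by
    have : a * x * (a * x) = a * x := by rw [← mul_assoc, h1]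
    rw [hg, mul_sub, mul_add, this, mul_one, add_sub_cancel_left]
  have hgQ : g * (x * a) = a * x * (x * a) := by
    have : x * a * (x * a) = x * a := by rw [← mul_assoc, h2]
    rw [hg, sub_mul, add_mul, this, one_mul, add_sub_cancel_right]
  have conj {p q : A} (hpq : g * p = q * g) : p * h = h * q := by
    calc p * h = h * g * p * h := by rw [hl, one_mul]
      _ = h * q * (g * h) := by rw [mul_assoc h g p, hpq]; simp only [mul_assoc]
      _ = h * q := by rw [hr, mul_one]
  have hPh : a * x * h = h * (x * a) := conj (hgP.trans hQg.symm)
  have hQh : x * a * h = h * (a * x) := conj (hgQ.trans hPg.symm)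
  have haPh : a * (a * x) * h = a := by
    calc a * (a * x) * h = a * x * a * (a * x) * h := by rw [h1]
      _ = a * (x * a * (a * x)) * h := by simp only [mul_assoc]
      _ = a * (x * a) * (g * h) := by rw [← hQg]; simp only [mul_assoc]
      _ = a := by rw [hr, mul_one, ← mul_assoc, h1]
  have hc : h * x = a * x * h * x := by rw [hPh, mul_assoc, h2]
  have hac : a * (h * x) = a * x := by
    rw [hc]
    calc a * (a * x * h * x) = a * (a * x) * h * x := by simp only [mul_assoc]
      _ = a * x := by rw [haPh]
  have hcaa : h * x * (a * a) = a := by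
    calc h * x * (a * a) = h * (x * a) * a := by simp only [mul_assoc]
      _ = a * x * h * (a * x * a) := by rw [← hPh, h1]
      _ = a * x * (h * (a * x)) * a := by simp only [mul_assoc]
      _ = a * x * (x * a) * h * a := by rw [← hQh]; simp only [mul_assoc]
      _ = a * x * (g * h) * a := by rw [← hPg]; simp only [mul_assoc]
      _ = a := by rw [hr, mul_one, h1]
  refine ⟨by rw [hac, h1], Set.Subset.antisymm ?_ ?_, Set.Subset.antisymm ?_ ?_⟩
  · rintro _ ⟨y, rfl⟩
    exact ⟨x * h * x * y, by
      simp only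
      rw [hc]
      simp only [mul_assoc]⟩
  · rintro _ ⟨y, rfl⟩
    exact ⟨a * a * y, by simp only; rw [← mul_assoc, hcaa]⟩
  · rintro _ ⟨y, rfl⟩
    refine ⟨y * (h * x * star x), ?_⟩
    simp only
    rw [mul_assoc, mul_assoc (h * x), ← star_mul, hP, mul_assoc h, ← mul_assoc x, h2]
  · rintro _ ⟨y, rfl⟩
    refine ⟨y * (star a * a), ?_⟩
    simp only
    rw [mul_assoc, mul_assoc (star a), hac, ← hP, ← star_mul, h1]

theorem stmt3 {A : Type*} [NormedRing A] [StarRing A] [CStarRing A]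
    [CompleteSpace A] [NormedAlgebra ℂ A] [StarModule ℂ A]
    (a : A) (ha : ∃ b, a * b * a = a) :
    (IsUnit (a * mpInv a + mpInv a * a - 1) ↔ ∃ x, IsCoreInv a x) ∧
    ((∃ x, IsCoreInv a x) →
      Ring.inverse (a * mpInv a + mpInv a * a - 1) =
        coreInv a * a + star (coreInv a * a) - 1) := by
  have hmp := mpInv_spec (exists_isMPInv_of_regular ha)
  refine ⟨⟨?_, ?_⟩, fun hcore => ?_⟩
  · rintro ⟨u, hu⟩
    exact ⟨_, hmp.isCoreInv_of_inverse (h := ↑u⁻¹) (by rw [← hu, u.inv_mul])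
      (by rw [← hu, u.mul_inv])⟩
  · rintro ⟨c, hc⟩
    exact isUnit_iff_exists.mpr ⟨_, hmp.mul_eq_one_of_isCoreInv hc,
      hmp.mul_eq_one_of_isCoreInv' hc⟩
  · have hc := coreInv_spec hcore
    exact Ring.inverse_unit ⟨_, _, hmp.mul_eq_one_of_isCoreInv hc,
      hmp.mul_eq_one_of_isCoreInv' hc⟩
end

section
/- Let A be a unital C*-algebra, a ∈ A, and let (a_n) be a sequence of core invertible (equivalently, dual core invertible) elements of A converging in norm to a. The following statements are equivalent: (i) a is core invertible and (a_n⊕) converges to a⊕; (ii) a is dual core invertible and (a_n⊖) converges to a⊖; (iii) a is group invertible and (a_n#) converges to a#; (iv) a is core invertible and the sequence (a_n⊕) is bounded; (v) a is dual core invertible and the sequence (a_n⊖) is bounded; (vi) a is Moore-Penrose invertible, (a_n†) converges to a†, and the sequence (a_n⊕·a_n) is bounded; (vii) a is Moore-Penrose invertible, (a_n†) converges to a†, and the sequence (a_n·a_n⊖) is bounded; (viii) a is Moore-Penrose invertible, (a_n†) converges to a†, and there exists ψ ∈ [0, π/2) such that ψ_{a_n} ≤ ψ for all n. -/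
open scoped Classical

section Algebra

variable {R : Type*} [Ring R]

theorem IsGroupInv.unique {a x y : R} (hx : IsGroupInv a x) (hy : IsGroupInv a y) : x = y := by
  obtain ⟨h1, h2, h3⟩ := hx
  obtain ⟨k1, k2, k3⟩ := hy
  have e1 : (a * x) * (a * y) = a * y := by rw [← mul_assoc, h1]
  have e2 : (x * a) * (y * a) = x * a := by rw [mul_assoc, ← mul_assoc a, k1]
  have e : a * x = a * y := by grind
  grind

theorem IsGroupInv.groupInv_eq {a g : R} (hg : IsGroupInv a g) : groupInv a = g := by
  have h : ∃ x, IsGroupInv a x := ⟨g, hg⟩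
  rw [groupInv, dif_pos h]
  exact h.choose_spec.unique hg

theorem range_mul_left_eq_iff {x b : R} :
    (Set.range fun y => x * y) = (Set.range fun y => b * y) ↔
      (∃ y, x = b * y) ∧ ∃ y, b = x * y := by
  constructor
  · intro h
    constructor
    · have : x ∈ Set.range fun y => x * y := ⟨1, mul_one x⟩
      rw [h] at this
      obtain ⟨y, hy⟩ := this
      exact ⟨y, hy.symm⟩
    · have : b ∈ Set.range fun y => b * y := ⟨1, mul_one b⟩
      rw [← h] at this
      obtain ⟨y, hy⟩ := this
      exact ⟨y, hy.symm⟩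
  · rintro ⟨⟨y, hy⟩, z, hz⟩
    ext w
    constructor
    · rintro ⟨v, rfl⟩
      exact ⟨y * v, by simp only [← mul_assoc, ← hy]⟩
    · rintro ⟨v, rfl⟩
      exact ⟨z * v, by simp only [← mul_assoc, ← hz]⟩

theorem range_mul_right_eq_iff {x b : R} :
    (Set.range fun y => y * x) = (Set.range fun y => y * b) ↔
      (∃ y, x = y * b) ∧ ∃ y, b = y * x := by
  constructor
  · intro h
    constructor
    · have : x ∈ Set.range fun y => y * x := ⟨1, one_mul x⟩
      rw [h] at this
      obtain ⟨y, hy⟩ := this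
      exact ⟨y, hy.symm⟩
    · have : b ∈ Set.range fun y => y * b := ⟨1, one_mul b⟩
      rw [← h] at this
      obtain ⟨y, hy⟩ := this
      exact ⟨y, hy.symm⟩
  · rintro ⟨⟨y, hy⟩, z, hz⟩
    ext w
    constructor
    · rintro ⟨v, rfl⟩
      exact ⟨v * y, by simp only [mul_assoc, ← hy]⟩
    · rintro ⟨v, rfl⟩
      exact ⟨v * z, by simp only [mul_assoc, ← hz]⟩

variable [StarRing R]

theorem IsMPInv.unique {a x y : R} (hx : IsMPInv a x) (hy : IsMPInv a y) : x = y := by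
  obtain ⟨h1, h2, h3, h4⟩ := hx
  obtain ⟨k1, k2, k3, k4⟩ := hy
  have e : a * x = a * y := by
    have h : a * y = a * x * (a * y) := by grind
    have := congrArg star h
    rw [star_mul (a * x), h3, k3] at this
    grind
  have e' : x * a = y * a := by
    have h : x * a = (x * a) * (y * a) := by grind
    have := congrArg star h
    rw [star_mul (x * a), h4, k4] at this
    grind
  grind

protected theorem IsGroupInv.star {a g : R} (h : IsGroupInv a g) :
    IsGroupInv (star a) (star g) := by
  obtain ⟨h1, h2, h3⟩ := h
  refine ⟨?_, ?_, ?_⟩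
  · simpa [mul_assoc] using congrArg star h1
  · simpa [mul_assoc] using congrArg star h2
  · simpa using (congrArg star h3).symm

protected theorem IsMPInv.star {a m : R} (h : IsMPInv a m) : IsMPInv (star a) (star m) := by
  obtain ⟨h1, h2, h3, h4⟩ := h
  refine ⟨?_, ?_, ?_, ?_⟩
  · simpa [mul_assoc] using congrArg star h1
  · simpa [mul_assoc] using congrArg star h2
  · simpa using h4.symm
  · simpa using h3.symm

theorem isDualCoreInv_iff_star {a x : R} :
    IsDualCoreInv a x ↔ IsCoreInv (star a) (star x) := by
  have key : ∀ c d : R, (∃ y, star c = star d * y) ↔ ∃ y, c = y * d := fun c d =>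
    ⟨fun ⟨y, hy⟩ => ⟨star y, by simpa using congrArg star hy⟩,
      fun ⟨y, hy⟩ => ⟨star y, by simpa using congrArg star hy⟩⟩
  have key' : ∀ c d : R, (∃ y, star c = y * star d) ↔ ∃ y, c = d * y := fun c d =>
    ⟨fun ⟨y, hy⟩ => ⟨star y, by simpa using congrArg star hy⟩,
      fun ⟨y, hy⟩ => ⟨star y, by simpa using congrArg star hy⟩⟩
  have h : a * x * a = a ↔ star a * star x * star a = star a := by
    rw [← star_inj (x := a * x * a)]
    simp [mul_assoc]
  unfold IsDualCoreInv IsCoreInv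
  rw [range_mul_left_eq_iff, range_mul_left_eq_iff, range_mul_right_eq_iff,
    range_mul_right_eq_iff, ← h, key, key, key', ← star_star a, key']
  simp only [star_star]
  tauto

theorem IsCoreInv.identities {a x : R} (h : IsCoreInv a x) :
    a * x * a = a ∧ x * a * x = x ∧ star (a * x) = a * x ∧ x * a * a = a ∧ a * x * x = x := by
  obtain ⟨h1, h2, h3⟩ := h
  obtain ⟨⟨y, hy⟩, w, hw⟩ := range_mul_left_eq_iff.1 h2
  obtain ⟨⟨z, hz⟩, -⟩ := range_mul_right_eq_iff.1 h3
  have e1 : star a * star x * star a = star a := by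
    simpa [mul_assoc] using congrArg star h1
  have e2 : x * star (a * x) = x := by
    rw [star_mul]; grind
  have e3 : star (a * x) = a * x := by
    have : a * x = a * x * star (a * x) := by rw [mul_assoc, e2]
    rw [this]; simp
  rw [e3] at e2
  refine ⟨h1, by grind, e3, ?_, ?_⟩
  · have : x * a * (x * w) = x * w := by grind
    rwa [← hw] at this
  · have : a * x * (a * y) = a * y := by grind
    rwa [← hy] at this

theorem IsCoreInv.isGroupInv {a x : R} (h : IsCoreInv a x) : IsGroupInv a (x * x * a) := by
  obtain ⟨h1, h2, h3, h4, h5⟩ := h.identities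
  refine ⟨?_, ?_, ?_⟩ <;> grind

theorem IsCoreInv.eq_mul {a x g m : R} (h : IsCoreInv a x) (hg : IsGroupInv a g)
    (hm : IsMPInv a m) : x = g * a * m := by
  have := h.isGroupInv.unique hg
  subst this
  obtain ⟨h1, h2, h3, h4, h5⟩ := h.identities
  obtain ⟨k1, k2, k3, k4⟩ := hm
  have e : a * x = a * m := by
    have e0 : a * x = (a * m) * (a * x) := by grind
    have := congrArg star e0
    rw [star_mul (a * m), h3, k3] at this
    grind
  have : x * x * a * a * m = x * (a * m) := by grind
  rw [this, ← e]; grind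

theorem IsGroupInv.isCoreInv {a g m : R} (hg : IsGroupInv a g) (hm : IsMPInv a m) :
    IsCoreInv a (g * a * m) := by
  obtain ⟨h1, h2, h3⟩ := hg
  obtain ⟨k1, k2, k3, k4⟩ := hm
  refine ⟨by grind, range_mul_left_eq_iff.2 ⟨⟨g * g * a * m, by grind⟩, a * a, by grind⟩,
    range_mul_right_eq_iff.2 ⟨⟨g * star m, ?_⟩, star a * a, ?_⟩⟩
  · rw [mul_assoc, mul_assoc, ← star_mul, k3]
  · have e : star a * (a * m) = star a := by
      conv_rhs => rw [← k1, star_mul, k3]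
    grind

theorem IsDualCoreInv.exists_isGroupInv {a x : R} (h : IsDualCoreInv a x) :
    ∃ g, IsGroupInv a g :=
  ⟨_, by simpa using (isDualCoreInv_iff_star.1 h).isGroupInv.star⟩

theorem IsDualCoreInv.eq_mul {a x g m : R} (h : IsDualCoreInv a x) (hg : IsGroupInv a g)
    (hm : IsMPInv a m) : x = m * a * g := by
  have := (isDualCoreInv_iff_star.1 h).eq_mul hg.star hm.star
  simpa [mul_assoc] using congrArg star this

theorem IsGroupInv.isDualCoreInv {a g m : R} (hg : IsGroupInv a g) (hm : IsMPInv a m) :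
    IsDualCoreInv a (m * a * g) := by
  rw [isDualCoreInv_iff_star]
  simpa [mul_assoc] using hg.star.isCoreInv hm.star

theorem IsMPInv.mpInv_eq {a m : R} (hm : IsMPInv a m) : mpInv a = m := by
  have h : ∃ x, IsMPInv a x := ⟨m, hm⟩
  rw [mpInv, dif_pos h]
  exact h.choose_spec.unique hm

theorem IsGroupInv.coreInv_eq {a g m : R} (hg : IsGroupInv a g) (hm : IsMPInv a m) :
    coreInv a = g * a * m := by
  have h : ∃ x, IsCoreInv a x := ⟨_, hg.isCoreInv hm⟩
  rw [coreInv, dif_pos h]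
  exact h.choose_spec.eq_mul hg hm

theorem IsGroupInv.dualCoreInv_eq {a g m : R} (hg : IsGroupInv a g) (hm : IsMPInv a m) :
    dualCoreInv a = m * a * g := by
  have h : ∃ x, IsDualCoreInv a x := ⟨_, hg.isDualCoreInv hm⟩
  rw [dualCoreInv, dif_pos h]
  exact h.choose_spec.eq_mul hg hm

/-- The idempotent `e = a * g` together with the range projections `p = a * m` and `q = m * a`. -/
theorem IsGroupInv.projection_identities {a g m : R} (hg : IsGroupInv a g) (hm : IsMPInv a m) :
    (a * m) * (a * g) = a * g ∧ (a * g) * (a * m) = a * m ∧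
      (m * a) * (a * g) = m * a ∧ (a * g) * (m * a) = a * g := by
  obtain ⟨h1, h2, h3⟩ := hg
  obtain ⟨k1, k2, k3, k4⟩ := hm
  refine ⟨?_, ?_, ?_, ?_⟩ <;> grind

theorem add_star_sub_one_mul_inv {e p q : R} (hp : star p = p) (hq : star q = q)
    (h1 : p * e = e) (h2 : e * p = p) (h3 : q * e = q) (h4 : e * q = e) :
    (p + q - 1) * (e + star e - 1) = 1 ∧ (e + star e - 1) * (p + q - 1) = 1 := by
  have h1' : star e * p = star e := by simpa [hp] using congrArg star h1
  have h2' : p * star e = p := by simpa [hp] using congrArg star h2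
  have h3' : star e * q = q := by simpa [hq] using congrArg star h3
  have h4' : q * star e = star e := by simpa [hq] using congrArg star h4
  constructor
  · simp only [add_mul, sub_mul, mul_add, mul_sub, one_mul, mul_one, h1, h2', h3, h4']; abel
  · simp only [add_mul, sub_mul, mul_add, mul_sub, one_mul, mul_one, h1', h2, h3', h4]; abel

theorem isMPInv_of_projections {a g p q : R} (hg : IsGroupInv a g) (hp : star p = p)
    (hq : star q = q) (h1 : p * (a * g) = a * g) (h2 : (a * g) * p = p)
    (h3 : q * (a * g) = q) (h4 : (a * g) * q = a * g) : IsMPInv a (q * g * p) := by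
  obtain ⟨k1, k2, k3⟩ := hg
  have aq : a * q = a := by
    have : a = a * (a * g) := by grind
    rw [this, mul_assoc, h4]
  have pa : p * a = a := by
    have : a = (a * g) * a := by grind
    rw [this, ← mul_assoc, h1]
  have e1 : a * (q * g * p) = p := by
    rw [mul_assoc, ← mul_assoc, aq, ← mul_assoc, h2]
  have e2 : q * g * p * a = q := by
    rw [mul_assoc, pa, mul_assoc, ← k3, h3]
  have qq : q * q = q := by
    calc q * q = q * ((a * g) * q) := by rw [← mul_assoc q, h3]
      _ = q := by rw [h4, h3]
  refine ⟨by rw [e1, pa], ?_, by rw [e1, hp], by rw [e2, hq]⟩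
  rw [e2, ← mul_assoc, ← mul_assoc, qq]

theorem IsGroupInv.exists_isMPInv_of_isUnit {a g : R} (hg : IsGroupInv a g)
    (hu : IsUnit (a * g + star (a * g) - 1)) : ∃ m, IsMPInv a m := by
  obtain ⟨u, hu⟩ := hu
  obtain ⟨h1, h2, h3⟩ := hg
  obtain ⟨e, he⟩ : ∃ e, e = a * g := ⟨_, rfl⟩
  have hee : e * e = e := by grind
  have hss : star e * star e = star e := by simpa using congrArg star hee
  rw [← he] at hu
  obtain ⟨v, hv⟩ : ∃ v, v = (↑u⁻¹ : R) := ⟨_, rfl⟩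
  have uv : (u : R) * v = 1 := by simp [hv]
  have vu : v * (u : R) = 1 := by simp [hv]
  have c1 : e * u = u * star e := by
    rw [hu]; simp only [add_mul, sub_mul, mul_add, mul_sub, one_mul, mul_one, hee, hss]; abel
  have c2 : star e * u = u * e := by
    rw [hu]; simp only [add_mul, sub_mul, mul_add, mul_sub, one_mul, mul_one, hee, hss]; abel
  have d1 : e * u = e * star e := by
    rw [hu]; simp only [mul_add, mul_sub, mul_one, hee]; abel
  have d2 : u * e = star e * e := by
    rw [hu]; simp only [add_mul, sub_mul, one_mul, hee]; abel
  have su : star (u : R) = u := by rw [hu]; simp [add_comm]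
  have sv : star v = v := by
    have h : star (u : R) * star v = 1 := by rw [← star_mul, vu, star_one]
    rw [su] at h
    calc star v = v * u * star v := by rw [vu, one_mul]
      _ = v := by rw [mul_assoc, h, mul_one]
  have f1 : v * e = star e * v := by
    calc v * e = v * (e * u) * v := by rw [mul_assoc, mul_assoc, uv, mul_one]
      _ = v * u * star e * v := by simp only [c1, mul_assoc]
      _ = _ := by rw [vu, one_mul]
  have f2 : v * star e = e * v := by
    calc v * star e = v * (star e * u) * v := by rw [mul_assoc, mul_assoc, uv, mul_one]
      _ = v * u * e * v := by simp only [c2, mul_assoc]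
      _ = _ := by rw [vu, one_mul]
  have eve : e * v * e = e := by
    rw [mul_assoc, f1, ← mul_assoc, ← d1, mul_assoc, uv, mul_one]
  refine ⟨v * e * g * (e * v), isMPInv_of_projections ⟨h1, h2, h3⟩ ?_ ?_ ?_ ?_ ?_ ?_⟩
  · rw [star_mul, sv, f2]
  · rw [star_mul, sv, f1]
  · rw [← he, eve]
  · rw [← he, ← mul_assoc, hee]
  · rw [← he, mul_assoc, hee]
  · rw [← he, ← mul_assoc, eve]

theorem IsMPInv.isStarProjection_mul_inv {a m : R} (hm : IsMPInv a m) :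
    IsStarProjection (a * m) :=
  ⟨by rw [IsIdempotentElem, ← mul_assoc, hm.1], hm.2.2.1⟩

theorem IsMPInv.isStarProjection_inv_mul {a m : R} (hm : IsMPInv a m) :
    IsStarProjection (m * a) :=
  ⟨by rw [IsIdempotentElem, ← mul_assoc, hm.2.1], hm.2.2.2⟩

theorem IsGroupInv.inverse_add_star_sub_one {a g m : R} (hg : IsGroupInv a g)
    (hm : IsMPInv a m) :
    Ring.inverse (a * g + star (a * g) - 1) = a * m + m * a - 1 := by
  obtain ⟨h1, h2, h3, h4⟩ := hg.projection_identities hm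
  obtain ⟨vu, uv⟩ := add_star_sub_one_mul_inv hm.2.2.1 hm.2.2.2 h1 h2 h3 h4
  exact Ring.inverse_unit ⟨_, _, uv, vu⟩

theorem IsGroupInv.mpInv_formula {a g m : R} (hg : IsGroupInv a g) (hm : IsMPInv a m) :
    m = Ring.inverse (a * g + star (a * g) - 1) * (a * g) * g *
      (a * g * Ring.inverse (a * g + star (a * g) - 1)) := by
  obtain ⟨h1, h2, h3, h4⟩ := hg.projection_identities hm
  have e1 : (a * m + m * a - 1) * (a * g) = m * a := by
    rw [sub_mul, add_mul, h1, h3]; noncomm_ring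
  have e2 : (a * g) * (a * m + m * a - 1) = a * m := by
    rw [mul_sub, mul_add, h2, h4]; noncomm_ring
  rw [hg.inverse_add_star_sub_one hm, e1, e2]
  obtain ⟨h1, h2, h3⟩ := hg
  obtain ⟨k1, k2, k3, k4⟩ := hm
  have : m * a * g * (a * m) = m * (a * g * a) * m := by simp only [mul_assoc]
  rw [this, h1, k2]

end Algebra

section CStar

open Filter Topology

variable {A : Type*} [NormedRing A] [StarRing A] [CStarRing A]

theorem CStarRing.norm_one_le : ‖(1 : A)‖ ≤ 1 :=
  IsStarProjection.norm_le 1 (by simp)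

theorem IsMPInv.norm_inv_sub_inv_le {a m b n : A} (hm : IsMPInv a m) (hn : IsMPInv b n) :
    ‖n - m‖ ≤ (‖n‖ * ‖m‖ + ‖n‖ * ‖n‖ * ‖1 - a * m‖ + 2 * (‖m‖ * ‖m‖)) * ‖b - a‖ := by
  have k1 : star n * star b = b * n := by rw [← star_mul, hn.2.2.1]
  have k2 : star a * star m = m * a := by rw [← star_mul, hm.2.2.2]
  have k3 : star a * (1 - a * m) = 0 := by
    have : star ((1 - a * m) * a) = 0 := by rw [sub_mul, hm.1, one_mul, sub_self, star_zero]
    rwa [star_mul, star_sub, star_one, hm.2.2.1] at this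
  have k4 : (1 - n * b) * star b = 0 := by
    have : star (b * (1 - n * b)) = 0 := by
      rw [mul_sub, ← mul_assoc, hn.1, mul_one, sub_self, star_zero]
    rwa [star_mul, star_sub, star_one, hn.2.2.2] at this
  have e2 : n * star n * star (b - a) * (1 - a * m) = n - n * a * m := by
    have h : n * star n * star (b - a) * (1 - a * m)
        = n * (star n * star b) * (1 - a * m) - n * star n * (star a * (1 - a * m)) := by
      rw [star_sub]; noncomm_ring
    rw [h, k1, k3, ← mul_assoc, hn.2.1]; noncomm_ring
  have e3 : (1 - n * b) * star (b - a) * star m * m = n * b * m - m := by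
    have h : (1 - n * b) * star (b - a) * star m * m
        = (1 - n * b) * star b * star m * m - (1 - n * b) * ((star a * star m) * m) := by
      rw [star_sub]; noncomm_ring
    rw [h, k2, k4, hm.2.1]; noncomm_ring
  have key : n - m = -(n * (b - a) * m) + n * star n * star (b - a) * (1 - a * m)
      + (1 - n * b) * star (b - a) * star m * m := by
    rw [e2, e3]; noncomm_ring
  have hP : ‖1 - n * b‖ ≤ 2 := by
    have h1 := CStarRing.norm_one_le (A := A)
    have h2 := hn.isStarProjection_inv_mul.norm_le
    linarith [norm_sub_le (1 : A) (n * b)]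
  have b1 : ‖n * (b - a) * m‖ ≤ ‖n‖ * ‖b - a‖ * ‖m‖ := norm_mul₃_le
  have b2 : ‖n * star n * star (b - a) * (1 - a * m)‖
      ≤ ‖n‖ * ‖n‖ * ‖b - a‖ * ‖1 - a * m‖ := by
    refine (norm_mul_le _ _).trans ?_
    gcongr
    refine norm_mul₃_le.trans ?_
    rw [norm_star, norm_star]
  have b3 : ‖(1 - n * b) * star (b - a) * star m * m‖ ≤ 2 * ‖b - a‖ * ‖m‖ * ‖m‖ := by
    refine (norm_mul_le _ _).trans ?_
    gcongr
    refine norm_mul₃_le.trans ?_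
    rw [norm_star, norm_star]
    gcongr
  rw [key]
  refine norm_add₃_le.trans ?_
  rw [norm_neg]
  linarith

theorem IsMPInv.tendsto_of_norm_le {a m : A} {s t : ℕ → A} (hm : IsMPInv a m)
    (ht : ∀ n, IsMPInv (s n) (t n)) (hs : Tendsto s atTop (𝓝 a)) {K : ℝ}
    (hK : ∀ n, ‖t n‖ ≤ K) : Tendsto t atTop (𝓝 m) := by
  rw [tendsto_iff_norm_sub_tendsto_zero] at hs ⊢
  have h := hs.const_mul (K * ‖m‖ + K * K * ‖1 - a * m‖ + 2 * (‖m‖ * ‖m‖))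
  rw [mul_zero] at h
  refine squeeze_zero (fun _ => norm_nonneg _) (fun n => ?_) h
  refine (hm.norm_inv_sub_inv_le (ht n)).trans ?_
  have hK0 : 0 ≤ K := (norm_nonneg _).trans (hK n)
  have := hK n
  gcongr

theorem norm_sub_le_of_projection_identities {B : Type*} [NormedRing B] {e p q e' p' q' : B}
    (h2 : e * p = p) (h4 : e * q = e) (k1 : p' * e' = e') (k3 : q' * e' = q') :
    ‖e - e'‖ ≤ ‖e‖ * ‖q - q'‖ * ‖1 - e'‖ + ‖1 - e‖ * ‖p - p'‖ * ‖e'‖ := by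
  have e1 : e * (q - q') * (1 - e') = e - e * e' := by
    have : e * (q - q') * (1 - e') = e * q * (1 - e') - e * (q' - q' * e') := by noncomm_ring
    rw [this, h4, k3]; noncomm_ring
  have e2 : (1 - e) * (p - p') * e' = e * e' - e' := by
    have : (1 - e) * (p - p') * e' = (p - e * p) * e' - (1 - e) * (p' * e') := by noncomm_ring
    rw [this, h2, k1]; noncomm_ring
  have key : e - e' = e * (q - q') * (1 - e') + (1 - e) * (p - p') * e' := by
    rw [e1, e2]; abel
  rw [key]
  exact (norm_add_le _ _).trans (add_le_add norm_mul₃_le norm_mul₃_le)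

theorem cauchySeq_of_projection_identities {e p q : ℕ → A}
    (h1 : ∀ n, p n * e n = e n) (h2 : ∀ n, e n * p n = p n) (h3 : ∀ n, q n * e n = q n)
    (h4 : ∀ n, e n * q n = e n) (hp : CauchySeq p) (hq : CauchySeq q) {C : ℝ}
    (hC : ∀ n, ‖e n‖ ≤ C) : CauchySeq e := by
  rw [cauchySeq_iff_tendsto_dist_atTop_0] at hp hq ⊢
  have h := (hq.const_mul (C * (1 + C))).add (hp.const_mul ((1 + C) * C))
  rw [mul_zero, mul_zero, add_zero] at h
  refine squeeze_zero (fun _ => dist_nonneg) (fun n => ?_) h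
  have hC0 : 0 ≤ C := (norm_nonneg _).trans (hC 0)
  have hb : ∀ k, ‖1 - e k‖ ≤ 1 + C := fun k =>
    (norm_sub_le _ _).trans (add_le_add CStarRing.norm_one_le (hC k))
  rw [dist_eq_norm, dist_eq_norm, dist_eq_norm]
  refine (norm_sub_le_of_projection_identities (h2 n.1) (h4 n.1) (h1 n.2) (h3 n.2)).trans ?_
  have := hC n.1
  have := hC n.2
  have := hb n.1
  have := hb n.2
  calc _ ≤ C * ‖q n.1 - q n.2‖ * (1 + C) + (1 + C) * ‖p n.1 - p n.2‖ * C := by gcongr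
    _ = _ := by ring

theorem norm_le_of_norm_sub_le {e p q : A} (hq : IsStarProjection q) (h1 : p * e = e)
    (h3 : q * e = q) {c : ℝ} (hc : c < 1) (h : ‖p - q‖ ≤ c) : ‖e‖ ≤ 1 / (1 - c) := by
  have key : e = q + (p - q) * e := by rw [sub_mul, h1, h3]; abel
  have b : ‖e‖ ≤ 1 + c * ‖e‖ := by
    conv_lhs => rw [key]
    refine (norm_add_le _ _).trans (add_le_add hq.norm_le ((norm_mul_le _ _).trans ?_))
    gcongr
  rw [le_div_iff₀ (by linarith)]
  linarith

variable [CompleteSpace A]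

theorem exists_isGroupInv_tendsto {a m : A} {s t r : ℕ → A}
    (ht : ∀ n, IsGroupInv (s n) (t n)) (hr : ∀ n, IsMPInv (s n) (r n))
    (hs : Tendsto s atTop (𝓝 a)) (hrm : Tendsto r atTop (𝓝 m))
    {C : ℝ} (hC : ∀ n, ‖s n * t n‖ ≤ C) : ∃ g, IsGroupInv a g ∧ Tendsto t atTop (𝓝 g) := by
  have hid := fun n => (ht n).projection_identities (hr n)
  obtain ⟨e, he⟩ := cauchySeq_tendsto_of_complete
    (cauchySeq_of_projection_identities (fun n => (hid n).1) (fun n => (hid n).2.1)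
      (fun n => (hid n).2.2.1) (fun n => (hid n).2.2.2) (hs.mul hrm).cauchySeq
      (hrm.mul hs).cauchySeq hC)
  have htg : Tendsto t atTop (𝓝 (e * m * e)) := by
    have h : t = fun n => s n * t n * r n * (s n * t n) := by
      funext n
      obtain ⟨h1, h2, h3⟩ := ht n
      obtain ⟨k1, k2, k3, k4⟩ := hr n
      grind
    rw [h]
    exact (he.mul hrm).mul he
  refine ⟨_, ⟨?_, ?_, ?_⟩, htg⟩
  · exact tendsto_nhds_unique ((hs.mul htg).mul hs) (by simpa only [(ht _).1] using hs)
  · exact tendsto_nhds_unique ((htg.mul hs).mul htg) (by simpa only [(ht _).2.1] using htg)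
  · exact tendsto_nhds_unique (hs.mul htg) (by simpa only [(ht _).2.2] using htg.mul hs)

variable [NormedAlgebra ℂ A] [StarModule ℂ A]

theorem isUnit_add_star_sub_one_of_isIdempotentElem {e : A} (he : IsIdempotentElem e) :
    IsUnit (e + star e - 1) := by
  let _ : CStarAlgebra A := {}
  let _ := CStarAlgebra.spectralOrder A
  have _ := CStarAlgebra.spectralOrderedRing A
  have h : IsUnit (1 + star (e - star e) * (e - star e)) :=
    CStarAlgebra.isUnit_of_le 1 (le_add_of_nonneg_right (star_mul_self_nonneg _))
  have he' : e * e = e := he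
  have hs : star e * star e = star e := by simpa using congrArg star he'
  have : (e + star e - 1) ^ 2 = 1 + star (e - star e) * (e - star e) := by
    rw [pow_two, star_sub, star_star]
    simp only [add_mul, sub_mul, mul_add, mul_sub, one_mul, mul_one, he', hs]
    abel
  rw [← this] at h
  exact (isUnit_pow_iff two_ne_zero).1 h

theorem IsGroupInv.isUnit_add_star_sub_one {a g : A} (hg : IsGroupInv a g) :
    IsUnit (a * g + star (a * g) - 1) :=
  isUnit_add_star_sub_one_of_isIdempotentElem (by rw [IsIdempotentElem, ← mul_assoc, hg.1])

theorem IsGroupInv.exists_isMPInv {a g : A} (hg : IsGroupInv a g) : ∃ m, IsMPInv a m :=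
  hg.exists_isMPInv_of_isUnit hg.isUnit_add_star_sub_one

theorem IsStarProjection.norm_sub_sq_le {e p q : A} (hp : IsStarProjection p)
    (hq : IsStarProjection q) (h1 : p * e = e) (h2 : e * p = p) (h3 : q * e = q)
    (h4 : e * q = e) {K : ℝ} (hK : 1 ≤ K) (he : ‖e + star e - 1‖ ≤ K) :
    ‖p - q‖ ^ 2 ≤ 1 - (K ^ 2)⁻¹ := by
  let _ : CStarAlgebra A := {}
  let _ := CStarAlgebra.spectralOrder A
  have _ := CStarAlgebra.spectralOrderedRing A
  have hps : star p = p := hp.isSelfAdjoint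
  have hqs : star q = q := hq.isSelfAdjoint
  have hpp : p * p = p := hp.isIdempotentElem
  have hqq : q * q = q := hq.isIdempotentElem
  obtain ⟨vu, uv⟩ := add_star_sub_one_mul_inv hps hqs h1 h2 h3 h4
  have hu : IsSelfAdjoint (e + star e - 1) := by
    rw [IsSelfAdjoint]; simp [add_comm]
  have hd : IsSelfAdjoint (p - q) := by rw [IsSelfAdjoint, star_sub, hps, hqs]
  have hv : star (p + q - 1) = p + q - 1 := by rw [star_sub, star_add, hps, hqs, star_one]
  set u := e + star e - 1
  set v := p + q - 1 with hvdef
  have hK0 : 0 < K ^ 2 := by positivity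
  have hdv : (p - q) * (p - q) = 1 - v * v := by
    rw [hvdef]
    simp only [add_mul, sub_mul, mul_add, mul_sub, one_mul, mul_one, hpp, hqq]
    abel
  have huu : ‖u * u‖ ≤ K ^ 2 := by
    rw [hu.norm_mul_self]; gcongr
  have hvv : 0 ≤ v * v := by
    have := star_mul_self_nonneg v
    rwa [hv] at this
  have h : (1 : A) ≤ K ^ 2 • (v * v) := by
    have hsa : IsSelfAdjoint (u * u) := by rw [IsSelfAdjoint, star_mul, hu.star_eq]
    have := CStarAlgebra.star_left_conjugate_le_norm_smul (a := v) (b := u * u) hsa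
    rw [hv, ← mul_assoc, vu, one_mul, uv] at this
    exact this.trans (smul_le_smul_of_nonneg_right huu hvv)
  have h' : (K ^ 2)⁻¹ • (1 : A) ≤ v * v := by
    have := smul_le_smul_of_nonneg_left h (inv_nonneg.2 hK0.le)
    rwa [smul_smul, inv_mul_cancel₀ hK0.ne', one_smul] at this
  have hle : (p - q) * (p - q) ≤ algebraMap ℝ A (1 - (K ^ 2)⁻¹) := by
    rw [hdv, map_sub, map_one, Algebra.algebraMap_eq_smul_one]
    exact sub_le_sub_left h' 1
  have hd0 : 0 ≤ (p - q) * (p - q) := by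
    have := star_mul_self_nonneg (p - q)
    rwa [hd.star_eq] at this
  have hr : 0 ≤ 1 - (K ^ 2)⁻¹ := by
    have : (K ^ 2)⁻¹ ≤ 1 := inv_le_one_of_one_le₀ (one_le_pow₀ hK)
    linarith
  rw [← hd.norm_mul_self]
  exact (CStarAlgebra.norm_le_iff_le_algebraMap _ hr hd0).2 hle

theorem IsGroupInv.tendsto_mpInv {a g m : A} {s t r : ℕ → A} (hg : IsGroupInv a g)
    (hm : IsMPInv a m) (ht : ∀ n, IsGroupInv (s n) (t n)) (hr : ∀ n, IsMPInv (s n) (r n))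
    (hs : Tendsto s atTop (𝓝 a)) (htg : Tendsto t atTop (𝓝 g)) :
    Tendsto r atTop (𝓝 m) := by
  have he := hs.mul htg
  have hu : Tendsto (fun n => s n * t n + star (s n * t n) - 1) atTop
      (𝓝 (a * g + star (a * g) - 1)) := (he.add he.star).sub_const 1
  obtain ⟨u, hu'⟩ := hg.isUnit_add_star_sub_one
  have hv : Tendsto (fun n => Ring.inverse (s n * t n + star (s n * t n) - 1)) atTop
      (𝓝 (Ring.inverse (a * g + star (a * g) - 1))) := by
    rw [← hu'] at hu ⊢
    exact (NormedRing.inverse_continuousAt u).tendsto.comp hu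
  rw [hg.mpInv_formula hm, funext fun n => (ht n).mpInv_formula (hr n)]
  exact ((hv.mul he).mul htg).mul (he.mul hv)

end CStar

theorem stmt5 {A : Type*} [NormedRing A] [StarRing A] [CStarRing A]
    [CompleteSpace A] [NormedAlgebra ℂ A] [StarModule ℂ A]
    (a : A) (s : ℕ → A) (hs : ∀ n, ∃ x, IsCoreInv (s n) x)
    (hconv : Filter.Tendsto s Filter.atTop (nhds a)) :
    List.TFAE
      [(∃ x, IsCoreInv a x) ∧
         Filter.Tendsto (fun n => coreInv (s n)) Filter.atTop (nhds (coreInv a)),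
       (∃ x, IsDualCoreInv a x) ∧
         Filter.Tendsto (fun n => dualCoreInv (s n)) Filter.atTop (nhds (dualCoreInv a)),
       (∃ x, IsGroupInv a x) ∧
         Filter.Tendsto (fun n => groupInv (s n)) Filter.atTop (nhds (groupInv a)),
       (∃ x, IsCoreInv a x) ∧ ∃ C, ∀ n, ‖coreInv (s n)‖ ≤ C,
       (∃ x, IsDualCoreInv a x) ∧ ∃ C, ∀ n, ‖dualCoreInv (s n)‖ ≤ C,
       (∃ x, IsMPInv a x) ∧
         Filter.Tendsto (fun n => mpInv (s n)) Filter.atTop (nhds (mpInv a)) ∧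
         ∃ C, ∀ n, ‖coreInv (s n) * s n‖ ≤ C,
       (∃ x, IsMPInv a x) ∧
         Filter.Tendsto (fun n => mpInv (s n)) Filter.atTop (nhds (mpInv a)) ∧
         ∃ C, ∀ n, ‖s n * dualCoreInv (s n)‖ ≤ C,
       (∃ x, IsMPInv a x) ∧
         Filter.Tendsto (fun n => mpInv (s n)) Filter.atTop (nhds (mpInv a)) ∧
         ∃ ψ, 0 ≤ ψ ∧ ψ < Real.pi / 2 ∧ ∀ n, maxAngle (s n) ≤ ψ] := by
  choose x hx using hs
  have hg : ∀ n, ∃ g, IsGroupInv (s n) g := fun n => ⟨_, (hx n).isGroupInv⟩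
  choose g hg using hg
  have hm : ∀ n, ∃ m, IsMPInv (s n) m := fun n => (hg n).exists_isMPInv
  choose m hm using hm
  have hcore : ∀ n, coreInv (s n) = g n * s n * m n := fun n => (hg n).coreInv_eq (hm n)
  have hdual : ∀ n, dualCoreInv (s n) = m n * s n * g n := fun n => (hg n).dualCoreInv_eq (hm n)
  have hce : ∀ n, coreInv (s n) * s n = s n * g n := fun n => by
    obtain ⟨h1, h2, h3⟩ := hg n
    rw [hcore, mul_assoc, mul_assoc, ← mul_assoc (s n), (hm n).1, h3]
  have hde : ∀ n, s n * dualCoreInv (s n) = s n * g n := fun n => by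
    rw [hdual, ← mul_assoc, ← mul_assoc, (hm n).1]
  have hbdd : ∀ {u : ℕ → A} {b : A}, Filter.Tendsto u Filter.atTop (nhds b) →
      ∃ C, ∀ n, ‖u n‖ ≤ C := fun {u b} h => by
    obtain ⟨C, hC⟩ := (Metric.isBounded_range_of_tendsto u h).exists_norm_le
    exact ⟨C, fun n => hC _ ⟨n, rfl⟩⟩
  obtain ⟨S, hS⟩ := hbdd hconv
  have hS0 : 0 ≤ S := (norm_nonneg _).trans (hS 0)
  simp only [hce, hde, funext fun n => (hg n).groupInv_eq, funext fun n => (hm n).mpInv_eq]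
  have group_of_mp : (∃ y, IsMPInv a y) → Filter.Tendsto m Filter.atTop (nhds (mpInv a)) →
      (∃ C, ∀ n, ‖s n * g n‖ ≤ C) → ∃ h k, IsGroupInv a h ∧ IsMPInv a k ∧
        Filter.Tendsto g Filter.atTop (nhds h) ∧ Filter.Tendsto m Filter.atTop (nhds k) := by
    rintro ⟨k, hk⟩ hlim ⟨C, hC⟩
    rw [hk.mpInv_eq] at hlim
    obtain ⟨h, hh, hgh⟩ := exists_isGroupInv_tendsto hg hm hconv hlim hC
    exact ⟨h, k, hh, hk, hgh, hlim⟩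
  have mp_of_bdd : ∀ {h : A}, IsGroupInv a h → ∀ {K : ℝ}, (∀ n, ‖m n‖ ≤ K) →
      (∃ y, IsMPInv a y) ∧ Filter.Tendsto m Filter.atTop (nhds (mpInv a)) := by
    intro h hh K hK
    obtain ⟨k, hk⟩ := hh.exists_isMPInv
    exact ⟨⟨k, hk⟩, by rw [hk.mpInv_eq]; exact hk.tendsto_of_norm_le hm hconv hK⟩
  tfae_have 1 → 4 := fun ⟨h, hlim⟩ => ⟨h, hbdd hlim⟩
  tfae_have 2 → 5 := fun ⟨h, hlim⟩ => ⟨h, hbdd hlim⟩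
  tfae_have 6 ↔ 7 := Iff.rfl
  tfae_have 3 → 6 := by
    rintro ⟨⟨h, hh⟩, hlim⟩
    rw [hh.groupInv_eq] at hlim
    obtain ⟨k, hk⟩ := hh.exists_isMPInv
    refine ⟨⟨k, hk⟩, ?_, hbdd (hconv.mul hlim)⟩
    rw [hk.mpInv_eq]
    exact hh.tendsto_mpInv hk hg hm hconv hlim
  tfae_have 4 → 6 := by
    rintro ⟨⟨y, hy⟩, C, hC⟩
    have hC0 : 0 ≤ C := (norm_nonneg _).trans (hC 0)
    have hK : ∀ n, ‖m n‖ ≤ 1 * C := fun n => by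
      have : m n = m n * s n * coreInv (s n) := by
        rw [hcore, ← mul_assoc, mul_assoc (m n), ← mul_assoc (s n), mul_assoc (m n), (hg n).1,
          ← mul_assoc, (hm n).2.1]
      rw [this]
      refine (norm_mul_le _ _).trans ?_
      gcongr
      exacts [(hm n).isStarProjection_inv_mul.norm_le, hC n]
    obtain ⟨h1, h2⟩ := mp_of_bdd hy.isGroupInv hK
    refine ⟨h1, h2, C * S, fun n => ?_⟩
    rw [← hce]
    refine (norm_mul_le _ _).trans ?_
    have := hC n
    have := hS n
    gcongr
  tfae_have 5 → 6 := by
    rintro ⟨⟨y, hy⟩, C, hC⟩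
    have hC0 : 0 ≤ C := (norm_nonneg _).trans (hC 0)
    have hK : ∀ n, ‖m n‖ ≤ C * 1 := fun n => by
      have : m n = dualCoreInv (s n) * (s n * m n) := by
        rw [hdual, mul_assoc (m n), mul_assoc (m n), ← mul_assoc (s n * g n), (hg n).1,
          ← mul_assoc, (hm n).2.1]
      rw [this]
      refine (norm_mul_le _ _).trans ?_
      gcongr
      exacts [hC n, (hm n).isStarProjection_mul_inv.norm_le]
    obtain ⟨h, hh⟩ := hy.exists_isGroupInv
    obtain ⟨h1, h2⟩ := mp_of_bdd hh hK
    refine ⟨h1, h2, S * C, fun n => ?_⟩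
    rw [← hde]
    refine (norm_mul_le _ _).trans ?_
    have := hC n
    have := hS n
    gcongr
  tfae_have 6 → 1 := by
    rintro ⟨h1, h2, h3⟩
    obtain ⟨h, k, hh, hk, hgh, hmk⟩ := group_of_mp h1 h2 h3
    refine ⟨⟨_, hh.isCoreInv hk⟩, ?_⟩
    rw [hh.coreInv_eq hk, funext hcore]
    exact (hgh.mul hconv).mul hmk
  tfae_have 6 → 2 := by
    rintro ⟨h1, h2, h3⟩
    obtain ⟨h, k, hh, hk, hgh, hmk⟩ := group_of_mp h1 h2 h3
    refine ⟨⟨_, hh.isDualCoreInv hk⟩, ?_⟩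
    rw [hh.dualCoreInv_eq hk, funext hdual]
    exact (hmk.mul hconv).mul hgh
  tfae_have 6 → 3 := by
    rintro ⟨h1, h2, h3⟩
    obtain ⟨h, k, hh, hk, hgh, hmk⟩ := group_of_mp h1 h2 h3
    exact ⟨⟨h, hh⟩, by rwa [hh.groupInv_eq]⟩
  tfae_have 6 → 8 := by
    rintro ⟨h1, h2, C, hC⟩
    refine ⟨h1, h2, ?_⟩
    have hC0 : 0 ≤ C := (norm_nonneg _).trans (hC 0)
    have hK : (1 : ℝ) ≤ C + C + 1 := by linarith
    have hK0 : 0 < (((C + C + 1) ^ 2)⁻¹ : ℝ) := by positivity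
    refine ⟨Real.arcsin √(1 - ((C + C + 1) ^ 2)⁻¹), Real.arcsin_nonneg.2 (Real.sqrt_nonneg _),
      Real.arcsin_lt_pi_div_two.2 ?_, fun n => Real.monotone_arcsin ?_⟩
    · rw [Real.sqrt_lt' one_pos]; linarith
    · obtain ⟨k1, k2, k3, k4⟩ := (hg n).projection_identities (hm n)
      rw [(hm n).mpInv_eq]
      refine Real.le_sqrt_of_sq_le ((hm n).isStarProjection_mul_inv.norm_sub_sq_le
        (hm n).isStarProjection_inv_mul k1 k2 k3 k4 hK ?_)
      refine (norm_sub_le _ _).trans (add_le_add ((norm_add_le _ _).trans ?_)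
        CStarRing.norm_one_le)
      rw [norm_star]
      exact add_le_add (hC n) (hC n)
  tfae_have 8 → 6 := by
    rintro ⟨h1, h2, ψ, hψ0, hψ, hle⟩
    refine ⟨h1, h2, 1 / (1 - Real.sin ψ), fun n => ?_⟩
    obtain ⟨k1, k2, k3, k4⟩ := (hg n).projection_identities (hm n)
    have hn := hle n
    rw [maxAngle, (hm n).mpInv_eq,
      Real.arcsin_le_iff_le_sin' ⟨by linarith [Real.pi_pos], hψ⟩] at hn
    refine norm_le_of_norm_sub_le (hm n).isStarProjection_inv_mul k1 k3 ?_ hn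
    rw [← Real.sin_pi_div_two]
    exact Real.sin_lt_sin_of_lt_of_le_pi_div_two (by linarith [Real.pi_pos]) le_rfl hψ
  tfae_finish
end

section
/- Let A be a unital C*-algebra and let a, b ∈ A be core invertible with b ≠ 0. Then ‖b⊕ − a⊕‖ ≤ ‖b† − a†‖ / cos ψ_b + ( ‖b⊕‖ + ‖a†‖ / cos ψ_b ) · ‖a⊕‖ · ‖a − b‖. -/
open scoped Classical

section StarRing

variable {A : Type*} [Ring A] [StarRing A]

theorem IsCoreInv.equations {a x : A} (h : IsCoreInv a x) :
    a * x * a = a ∧ x * a * x = x ∧ star (a * x) = a * x ∧ x * a * a = a ∧ a * x * x = x := by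
  obtain ⟨h1, h2, h3⟩ := h
  obtain ⟨u, hu⟩ : x ∈ Set.range fun y => a * y := h2 ▸ ⟨1, mul_one x⟩
  obtain ⟨v, hv⟩ : a ∈ Set.range fun y => x * y := h2 ▸ ⟨1, mul_one a⟩
  obtain ⟨w, hw⟩ : x ∈ Set.range fun y => y * star a := h3 ▸ ⟨1, one_mul x⟩
  simp only at hu hv hw
  have hxs : x * star (a * x) = x := by
    have : star a * star (a * x) = star a := by rw [← star_mul, h1]
    calc x * star (a * x) = w * (star a * star (a * x)) := by rw [← mul_assoc, hw]
      _ = x := by rw [this, hw]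
  have hsa : star (a * x) = a * x := by
    have h : a * x * star (a * x) = a * x := by rw [mul_assoc, hxs]
    rw [← h, star_mul, star_star]
  have hxax : x * a * x = x := by rw [hsa, ← mul_assoc] at hxs; exact hxs
  refine ⟨h1, hxax, hsa, ?_, ?_⟩
  · calc x * a * a = x * a * (x * v) := by rw [hv]
      _ = x * a * x * v := by noncomm_ring
      _ = a := by rw [hxax, hv]
  · calc a * x * x = a * x * (a * u) := by rw [hu]
      _ = a * x * a * u := by noncomm_ring
      _ = x := by rw [h1, hu]

theorem IsMPInv.isStarProjection_mul {a x : A} (h : IsMPInv a x) : IsStarProjection (a * x) :=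
  ⟨by rw [IsIdempotentElem, ← mul_assoc, h.1], h.2.2.1⟩

theorem IsMPInv.isStarProjection_mul' {a x : A} (h : IsMPInv a x) : IsStarProjection (x * a) :=
  ⟨by rw [IsIdempotentElem, ← mul_assoc, h.2.1], h.2.2.2⟩

theorem IsMPInv.mul_eq_of_isCoreInv {a x y : A} (hx : IsMPInv a x) (hy : IsCoreInv a y) :
    a * y = a * x := by
  obtain ⟨h1, -, h3, -, -⟩ := hy.equations
  obtain ⟨g1, -, g3, -⟩ := hx
  have h : a * x * (a * y) = a * y := by rw [← mul_assoc, g1]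
  have h' : a * y * (a * x) = a * x := by rw [← mul_assoc, h1]
  rw [← h', ← h3, ← g3, ← star_mul, h, h3]

theorem isMPInv_mpInv {a : A} (h : ∃ x, IsMPInv a x) : IsMPInv a (mpInv a) := by
  rw [mpInv, dif_pos h]
  exact h.choose_spec

theorem isCoreInv_coreInv {a : A} (h : ∃ x, IsCoreInv a x) : IsCoreInv a (coreInv a) := by
  rw [coreInv, dif_pos h]
  exact h.choose_spec

end StarRing

section CStarAlgebra

variable {A : Type*} [CStarAlgebra A]

theorem isUnit_one_add_star_mul_self (d : A) : IsUnit (1 + star d * d) := by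
  let _ := CStarAlgebra.spectralOrder A
  have _ := CStarAlgebra.spectralOrderedRing A
  exact CStarAlgebra.isUnit_of_le 1 (le_add_of_nonneg_right (star_mul_self_nonneg d))

/-- The left ideal generated by an idempotent is generated by a projection. -/
theorem exists_selfAdjoint_of_mul_self_eq {e : A} (he : e * e = e) :
    ∃ q : A, star q = q ∧ e * q = e ∧ q * e = q := by
  set f := star e with hf
  have hff : f * f = f := by rw [hf, ← star_mul, he]
  have hu : IsUnit (1 + star (f - e) * (f - e)) :=
    isUnit_one_add_star_mul_self _
  have hexp : 1 + star (f - e) * (f - e) = 1 - e - f + e * f + f * e := by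
    simp only [star_sub, hf, star_star]
    rw [← hf]
    simp only [mul_sub, sub_mul]
    grind
  obtain ⟨u, hu'⟩ := hu
  rw [hexp] at hu'
  have hcomm : Commute e (u : A) := by
    rw [hu', Commute, SemiconjBy]
    simp only [mul_add, mul_sub, add_mul, sub_mul, mul_one, one_mul]
    grind
  have hcomm' : Commute f (u : A) := by
    rw [hu', Commute, SemiconjBy]
    simp only [mul_add, mul_sub, add_mul, sub_mul, mul_one, one_mul]
    grind
  have hus : star (u : A) = u := by
    rw [hu']
    simp [hf]
    abel
  have hv : star (↑u⁻¹ : A) = ↑u⁻¹ := by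
    have : star u = u := Units.ext hus
    rw [← Units.coe_star_inv, this]
  have c1 := hcomm.units_inv_right
  have c2 := hcomm'.units_inv_right
  have hue : e * f * e = (u : A) * e := by
    rw [hu']
    simp only [add_mul, sub_mul, one_mul]
    grind
  refine ⟨f * e * ↑u⁻¹, ?_, ?_, ?_⟩
  · rw [star_mul, star_mul, hv, hf, star_star, ← hf, ← (c2.mul_left c1).eq]
  · rw [← mul_assoc, ← mul_assoc, hue, mul_assoc, c1.eq, ← mul_assoc, Units.mul_inv, one_mul]
  · rw [mul_assoc, ← c1.eq, ← mul_assoc, mul_assoc f, he]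

theorem IsCoreInv.exists_isMPInv {a y : A} (h : IsCoreInv a y) : ∃ x, IsMPInv a x := by
  obtain ⟨h1, h2, h3, -, -⟩ := h.equations
  obtain ⟨q, hq, heq, hqe⟩ := exists_selfAdjoint_of_mul_self_eq (e := y * a)
    (by rw [← mul_assoc, h2])
  have haq : a * q = a := by
    calc a * q = a * y * a * q := by rw [h1]
      _ = a * (y * a * q) := by noncomm_ring
      _ = a := by rw [heq, ← mul_assoc, h1]
  have hqq : q * q = q := by
    calc q * q = q * (y * a) * q := by rw [hqe]
      _ = q := by rw [mul_assoc, heq, hqe]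
  have e1 : a * (q * y) = a * y := by rw [← mul_assoc, haq]
  have e2 : q * y * a = q := by rw [mul_assoc, hqe]
  refine ⟨q * y, ?_, ?_, ?_, ?_⟩
  · rw [e1, h1]
  · rw [e2, ← mul_assoc, hqq]
  · rw [e1, h3]
  · rw [e2, hq]

/-- `e` is the oblique projection with the range of `p` and the kernel of `q`. -/
structure IsObliqueProj (e p q : A) : Prop where
  left : IsStarProjection p
  right : IsStarProjection q
  mul_left : e * p = p
  left_mul : p * e = e
  mul_right : e * q = e
  right_mul : q * e = q

namespace IsObliqueProj

variable {e p q : A}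

theorem one_sub (h : IsObliqueProj e p q) : IsObliqueProj (1 - e) (1 - q) (1 - p) where
  left := h.right.one_sub
  right := h.left.one_sub
  mul_left := by simp [mul_sub, sub_mul, h.mul_right]
  left_mul := by simp [mul_sub, sub_mul, h.right_mul]
  mul_right := by simp [mul_sub, sub_mul, h.mul_left]
  right_mul := by simp [mul_sub, sub_mul, h.left_mul]

theorem mul_star_left (h : IsObliqueProj e p q) : p * star e = p := by
  simpa [h.left.isSelfAdjoint.star_eq] using congrArg star h.mul_left

theorem star_mul_left (h : IsObliqueProj e p q) : star e * p = star e := by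
  simpa [h.left.isSelfAdjoint.star_eq] using congrArg star h.left_mul

theorem right_mul_star (h : IsObliqueProj e p q) : q * star e = star e := by
  simpa [h.right.isSelfAdjoint.star_eq] using congrArg star h.mul_right

theorem star_mul_right (h : IsObliqueProj e p q) : star e * q = q := by
  simpa [h.right.isSelfAdjoint.star_eq] using congrArg star h.right_mul

/-- `e * star e` is inverse to `p * q * p` in the corner of `p`. -/
theorem norm_sq_mul_le (h : IsObliqueProj e p q) : ‖e‖ ^ 2 * (1 - ‖p - q‖ ^ 2) ≤ 1 := by
  have hp := h.left.isIdempotentElem.eq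
  have hq := h.right.isIdempotentElem.eq
  have hsp := h.left.isSelfAdjoint.star_eq
  have hsq := h.right.isSelfAdjoint.star_eq
  have h1 := h.mul_star_left
  have h2 := h.right_mul_star
  have h3 := h.left_mul
  have h4 := h.right_mul
  have key : e * star e = p + star ((p - q) * p) * ((p - q) * p) * (e * star e) := by
    rw [star_mul, star_sub, hsp, hsq]
    simp only [mul_sub, sub_mul]
    grind
  have hn : ‖e * star e‖ = ‖e‖ ^ 2 := by rw [CStarRing.norm_self_mul_star, sq]
  have hpn : ‖p‖ ≤ 1 := IsStarProjection.norm_le p h.left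
  have hd : ‖(p - q) * p‖ ≤ ‖p - q‖ :=
    (norm_mul_le _ _).trans (mul_le_of_le_one_right (norm_nonneg _) hpn)
  have : ‖e‖ ^ 2 ≤ 1 + ‖p - q‖ ^ 2 * ‖e‖ ^ 2 := by
    calc ‖e‖ ^ 2 = ‖p + star ((p - q) * p) * ((p - q) * p) * (e * star e)‖ := by
          rw [← key, hn]
      _ ≤ ‖p‖ + ‖star ((p - q) * p) * ((p - q) * p)‖ * ‖e * star e‖ :=
          (norm_add_le _ _).trans (by gcongr; exact norm_mul_le _ _)
      _ ≤ 1 + ‖p - q‖ ^ 2 * ‖e‖ ^ 2 := by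
          rw [hn, CStarRing.norm_star_mul_self, ← sq]
          gcongr
  linarith

theorem left_le [PartialOrder A] [StarOrderedRing A] (h : IsObliqueProj e p q) :
    p ≤ ‖e‖ ^ 2 • (p * q * p) := by
  have hp := h.left.isIdempotentElem.eq
  have hq := h.right.isIdempotentElem.eq
  have hsp := h.left.isSelfAdjoint.star_eq
  have hsq := h.right.isSelfAdjoint.star_eq
  have key := CStarAlgebra.star_left_conjugate_le_norm_smul (a := q * p)
    (IsSelfAdjoint.star_mul_self e)
  have e1 : star (q * p) * (star e * e) * (q * p) = p := by
    have h1 := h.mul_star_left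
    have h2 := h.right_mul_star
    have h3 := h.mul_right
    have h4 := h.mul_left
    rw [star_mul, hsp, hsq]
    grind
  have e2 : star (q * p) * (q * p) = p * q * p := by
    rw [star_mul, hsp, hsq]
    grind
  rwa [e1, e2, CStarRing.norm_star_mul_self, ← sq] at key

theorem norm_sub_lt_one (h : IsObliqueProj e p q) (he : e ≠ 0) : ‖p - q‖ < 1 := by
  have hp := h.left.isIdempotentElem.eq
  have hq := h.right.isIdempotentElem.eq
  have e1 : (1 : A) - (p - q) * (p - q) = p * q * p + (1 - p) * (1 - q) * (1 - p) := by
    simp only [mul_sub, sub_mul, mul_one, one_mul]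
    grind
  let _ := CStarAlgebra.spectralOrder A
  have _ := CStarAlgebra.spectralOrderedRing A
  have hd : IsSelfAdjoint (p - q) := h.left.isSelfAdjoint.sub h.right.isSelfAdjoint
  have hqp : 0 ≤ q := h.right.nonneg
  have hsp := h.left.isSelfAdjoint
  set K := ‖e‖ ^ 2 + ‖1 - e‖ ^ 2 with hK
  have hKpos : 0 < K := by positivity
  have h' : IsObliqueProj (1 - star e) (1 - p) (1 - q) :=
    { left := h.left.one_sub
      right := h.right.one_sub
      mul_left := by simp [mul_sub, sub_mul, h.star_mul_left]
      left_mul := by simp [mul_sub, sub_mul, h.mul_star_left]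
      mul_right := by simp [mul_sub, sub_mul, h.star_mul_right]
      right_mul := by simp [mul_sub, sub_mul, h.right_mul_star] }
  have hn : ‖1 - star e‖ = ‖1 - e‖ := by rw [← norm_star, star_sub, star_one, star_star]
  have l1 := h.left_le
  have l2 := h'.left_le
  rw [hn] at l2
  have n1 : 0 ≤ p * q * p := hsp.conjugate_nonneg hqp
  have n2 : 0 ≤ (1 - p) * (1 - q) * (1 - p) :=
    h'.left.isSelfAdjoint.conjugate_nonneg h'.right.nonneg
  have l3 : p ≤ K • (p * q * p) :=
    l1.trans (smul_le_smul_of_nonneg_right (by rw [hK]; nlinarith [sq_nonneg ‖1 - e‖]) n1)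
  have l4 : 1 - p ≤ K • ((1 - p) * (1 - q) * (1 - p)) :=
    l2.trans (smul_le_smul_of_nonneg_right (by rw [hK]; nlinarith [sq_nonneg ‖e‖]) n2)
  have l5 : (1 : A) ≤ K • (1 - (p - q) * (p - q)) := by
    rw [e1, smul_add]
    simpa using add_le_add l3 l4
  have l6 : (p - q) * (p - q) ≤ algebraMap ℝ A (1 - K⁻¹) := by
    have := smul_le_smul_of_nonneg_left l5 (inv_nonneg.2 hKpos.le)
    rw [smul_smul, inv_mul_cancel₀ hKpos.ne', one_smul] at this
    rw [Algebra.algebraMap_eq_smul_one, sub_smul, one_smul]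
    exact le_sub_comm.1 this
  have hdd : 0 ≤ (p - q) * (p - q) := by
    have := star_mul_self_nonneg (p - q)
    rwa [hd.star_eq] at this
  have l7 : ‖(p - q) * (p - q)‖ ≤ max (1 - K⁻¹) 0 :=
    (CStarAlgebra.norm_le_iff_le_algebraMap _ (le_max_right _ _) hdd).2
      (l6.trans (algebraMap_mono A (le_max_left _ _)))
  have l8 : max (1 - K⁻¹) 0 < 1 := max_lt (by linarith [inv_pos.2 hKpos]) one_pos
  rw [hd.norm_mul_self] at l7
  have : ‖p - q‖ ^ 2 < 1 := l7.trans_lt l8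
  exact (sq_lt_one_iff₀ (norm_nonneg _)).1 this

theorem cos_arcsin_pos (h : IsObliqueProj e p q) (he : e ≠ 0) :
    0 < Real.cos (Real.arcsin ‖p - q‖) := by
  rw [Real.cos_arcsin]
  have h1 := h.norm_sub_lt_one he
  exact Real.sqrt_pos.2 (by nlinarith [norm_nonneg (p - q)])

theorem norm_mul_cos_arcsin_le_one (h : IsObliqueProj e p q) :
    ‖e‖ * Real.cos (Real.arcsin ‖p - q‖) ≤ 1 := by
  rw [Real.cos_arcsin]
  rcases le_total 0 (1 - ‖p - q‖ ^ 2) with h0 | h0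
  · refine (sq_le_one_iff₀ (by positivity)).1 ?_
    rw [mul_pow, Real.sq_sqrt h0]
    exact h.norm_sq_mul_le
  · simp [Real.sqrt_eq_zero_of_nonpos h0]

end IsObliqueProj

theorem IsCoreInv.isObliqueProj {b x c : A} (hx : IsCoreInv b x) (hc : IsMPInv b c) :
    IsObliqueProj (x * b) (b * c) (c * b) := by
  have hp := hc.mul_eq_of_isCoreInv hx
  obtain ⟨h1, h2, h3, h4, h5⟩ := hx.equations
  refine ⟨hc.isStarProjection_mul, hc.isStarProjection_mul', ?_, ?_, ?_, ?_⟩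
  · rw [← mul_assoc, h4]
  · rw [← hp, ← mul_assoc, h5]
  · rw [mul_assoc, ← mul_assoc b, hc.1]
  · rw [mul_assoc, ← mul_assoc b, h1]

theorem norm_coreInv_sub_le {a b x y c d : A} (hx : IsCoreInv b x) (hy : IsCoreInv a y)
    (hc : IsMPInv b c) (hd : IsMPInv a d) :
    ‖x - y‖ ≤ ‖x * b‖ * ‖c - d‖ + ‖x‖ * ‖a - b‖ * ‖y‖ + ‖1 - x * b‖ * (‖a - b‖ * ‖d‖ * ‖y‖) := by
  have hp := hc.mul_eq_of_isCoreInv hx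
  have hq := hd.mul_eq_of_isCoreInv hy
  have key : x - y = x * b * ((c - d) * (1 - a * d)) + x * (a - b) * y
      - (1 - x * b) * ((1 - b * c) * ((a - b) * d * y)) := by
    obtain ⟨h1, h2, h3, h4, h5⟩ := hx.equations
    obtain ⟨k1, k2, k3, k4, k5⟩ := hy.equations
    obtain ⟨g1, g2, -, -⟩ := hc
    obtain ⟨f1, f2, -, -⟩ := hd
    simp only [mul_sub, sub_mul, mul_one, one_mul]
    grind
  have n1 : ‖1 - a * d‖ ≤ 1 := IsStarProjection.norm_le _ hd.isStarProjection_mul.one_sub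
  have n2 : ‖1 - b * c‖ ≤ 1 := IsStarProjection.norm_le _ hc.isStarProjection_mul.one_sub
  rw [key]
  refine (norm_sub_le _ _).trans (add_le_add ((norm_add_le _ _).trans (add_le_add ?_ ?_)) ?_)
  · refine (norm_mul_le _ _).trans (mul_le_mul_of_nonneg_left ?_ (norm_nonneg _))
    exact (norm_mul_le _ _).trans (mul_le_of_le_one_right (norm_nonneg _) n1)
  · exact norm_mul₃_le
  · refine (norm_mul_le _ _).trans (mul_le_mul_of_nonneg_left ?_ (norm_nonneg _))
    refine (norm_mul_le _ _).trans ((mul_le_of_le_one_left (norm_nonneg _) n2).trans ?_)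
    exact norm_mul₃_le

end CStarAlgebra

theorem stmt10 {A : Type*} [NormedRing A] [StarRing A] [CStarRing A]
    [CompleteSpace A] [NormedAlgebra ℂ A] [StarModule ℂ A]
    (a b : A) (ha : ∃ x, IsCoreInv a x) (hb : ∃ x, IsCoreInv b x) (hb0 : b ≠ 0) :
    ‖coreInv b - coreInv a‖ ≤
      ‖mpInv b - mpInv a‖ / Real.cos (maxAngle b) +
        (‖coreInv b‖ + ‖mpInv a‖ / Real.cos (maxAngle b)) * ‖coreInv a‖ * ‖a - b‖ := by
  let _ : CStarAlgebra A := {}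
  have hy := isCoreInv_coreInv ha
  have hx := isCoreInv_coreInv hb
  have hd := isMPInv_mpInv hy.exists_isMPInv
  have hc := isMPInv_mpInv hx.exists_isMPInv
  have h := hx.isObliqueProj hc
  have he : coreInv b * b ≠ 0 := fun h0 => hb0 <| by
    rw [← hx.1, mul_assoc, h0, mul_zero]
  have hpos : 0 < Real.cos (maxAngle b) := h.cos_arcsin_pos he
  have h1 : ‖coreInv b * b‖ ≤ 1 / Real.cos (maxAngle b) :=
    (le_div_iff₀ hpos).2 h.norm_mul_cos_arcsin_le_one
  have h2 : ‖1 - coreInv b * b‖ ≤ 1 / Real.cos (maxAngle b) := by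
    have := h.one_sub.norm_mul_cos_arcsin_le_one
    rw [sub_sub_sub_cancel_left] at this
    exact (le_div_iff₀ hpos).2 this
  calc ‖coreInv b - coreInv a‖ ≤ _ := norm_coreInv_sub_le hx hy hc hd
    _ ≤ 1 / Real.cos (maxAngle b) * ‖mpInv b - mpInv a‖ + ‖coreInv b‖ * ‖a - b‖ * ‖coreInv a‖ +
        1 / Real.cos (maxAngle b) * (‖a - b‖ * ‖mpInv a‖ * ‖coreInv a‖) := by gcongr
    _ = _ := by ring
end
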